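/- Let (V, {f_{il}}) be a weak lower perfect space over k with a lower perfect basis B, and let ((i_1,l_1),…,(i_r,l_r)) be any finite sequence in I^∞. For any b ∈ B and any (a_1,…,a_r) ∈ ℤ_{≥0}^r, there exists c ∈ k^× such that f_{i_1l_1}^{a_1}⋯f_{i_rl_r}^{a_r}(b) − c·𝐟_{i_1l_1}^{a_1}⋯𝐟_{i_rl_r}^{a_r}(b) ∈ Σ_{k=1}^{r} f_{i_1l_1}^{a_1}⋯f_{i_{k−1}l_{k−1}}^{a_{k−1}} f_{i_kl_k}^{a_k+1} V. -/

import Mathlib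

open Function

/-- A weak lower perfect space: a `P`-graded `k`-vector space `V = ⊕_{μ ∈ P} V_μ`
with endomorphisms `f il` for `(i,l) ∈ I^∞ = I × ℤ_{>0}`. -/
structure WeakLowerPerfectSpace (k I P V : Type*) [Field k] [AddCommGroup P]
    [AddCommGroup V] [Module k V] where
  /-- the simple roots `α_i` -/
  alpha : I → P
  alpha_indep : LinearIndependent ℤ alpha
  /-- `P` is a free abelian group -/
  free : Module.Free ℤ P
  /-- the weight spaces `V_μ` -/
  weight : P → Submodule k V
  weight_indep : iSupIndep weight
  weight_sup : ⨆ μ : P, weight μ = ⊤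
  /-- the endomorphisms `f_{il}` -/
  f : I × ℕ+ → Module.End k V
  finiteDim : ∀ μ : P, Module.Finite k (weight μ)
  support_bounded : ∃ s : Finset P, ∀ μ : P, weight μ ≠ ⊥ →
    ∃ lam ∈ s, lam - μ ∈ AddSubmonoid.closure (Set.range alpha)
  f_weight : ∀ (i : I) (l : ℕ+) (μ : P),
    (weight μ).map (f (i, l)) ≤ weight (μ - (l : ℕ) • alpha i)

namespace WeakLowerPerfectSpace

variable {k I P V : Type*} [Field k] [AddCommGroup P] [AddCommGroup V] [Module k V]

/-- `d il v` is the unique `n` with `v ∈ f_{il}^n V \ f_{il}^{n+1} V` (for `v ≠ 0`),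
realized as the largest `n` with `v ∈ f_{il}^n V`. -/
noncomputable def d (S : WeakLowerPerfectSpace k I P V) (il : I × ℕ+) (v : V) : ℕ :=
  sSup {n : ℕ | v ∈ LinearMap.range (S.f il ^ n)}

end WeakLowerPerfectSpace

/-- A lower perfect basis `B` of a weak lower perfect space, with structure maps
`F il : B → B ∪ {0}` (extended by `F il 0 = 0`). -/
structure LowerPerfectBasis {k I P V : Type*} [Field k] [AddCommGroup P]
    [AddCommGroup V] [Module k V] (S : WeakLowerPerfectSpace k I P V) (B : Set V) where
  indep : LinearIndependent k (fun b : B => (b : V))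
  spans : Submodule.span k B = ⊤
  graded : ∀ b ∈ B, ∃ μ : P, b ∈ S.weight μ
  /-- the structure map `𝐟_{il}` -/
  F : I × ℕ+ → V → V
  F_zero : ∀ il : I × ℕ+, F il 0 = 0
  F_mem : ∀ il : I × ℕ+, ∀ b ∈ B, F il b ∈ B ∪ {0}
  F_approx : ∀ il : I × ℕ+, ∀ b ∈ B, ∃ c : kˣ,
    S.f il b - (c : k) • F il b ∈ LinearMap.range (S.f il ^ (S.d il b + 2))
  F_inj : ∀ b ∈ B, ∀ b' ∈ B, (∀ il : I × ℕ+, F il b = F il b') → b = b'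

namespace WeakLowerPerfectSpace

variable {k I P V : Type*} [Field k] [AddCommGroup P] [AddCommGroup V] [Module k V]

/-- The subspace `Σ_{(i,l) ∈ I^∞} f_{il} V`. -/
noncomputable def rad (S : WeakLowerPerfectSpace k I P V) : Submodule k V :=
  ⨆ il : I × ℕ+, LinearMap.range (S.f il)

/-- The highest core `B_H = {b ∈ B | d_{il}(b) = 0 for all (i,l) ∈ I^∞}`. -/
def highestCore (S : WeakLowerPerfectSpace k I P V) (B : Set V) : Set V :=
  {b | b ∈ B ∧ ∀ il : I × ℕ+, S.d il b = 0}

end WeakLowerPerfectSpace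

/-- Iterated application `𝐟_{i_1 l_1}^{a_1} ⋯ 𝐟_{i_r l_r}^{a_r}(b)` (rightmost factor applied
first): `fComp F seq a r b = F_{seq 0}^{a 0} (⋯ (F_{seq (r-1)}^{a (r-1)} b))`. -/
def fComp {V ι : Type*} (F : ι → V → V) (seq : ℕ → ι) (a : ℕ → ℕ) : ℕ → V → V
  | 0, v => v
  | m + 1, v => fComp F seq a m ((F (seq m))^[a m] v)

/-- Iterated application `𝐞_{i_r l_r}^{a_r} ⋯ 𝐞_{i_1 l_1}^{a_1}(b)` (leftmost index applied
first): `eComp E seq a r b = E_{seq (r-1)}^{a (r-1)} (⋯ (E_{seq 0}^{a 0} b))`. -/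
def eComp {V ι : Type*} (E : ι → V → V) (seq : ℕ → ι) (a : ℕ → ℕ) : ℕ → V → V
  | 0, v => v
  | m + 1, v => (E (seq m))^[a m] (eComp E seq a m v)

/-- The sequence `b_0 = b`, `b_{k+1} = 𝐞_{i_{k+1} l_{k+1}}^{d_{i_{k+1} l_{k+1}}(b_k)}(b_k)`. -/
def bseq {V ι : Type*} (E : ι → V → V) (d : ι → V → ℕ) (seq : ℕ → ι) (b : V) : ℕ → V
  | 0 => b
  | m + 1 => (E (seq m))^[d (seq m) (bseq E d seq b m)] (bseq E d seq b m)

/-- The lexicographic strict order on sequences of non-negative integers. -/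
def SeqLt (a a' : ℕ → ℕ) : Prop :=
  ∃ m : ℕ, (∀ s < m, a s = a' s) ∧ a m < a' m

/-- The lexicographic order on sequences of non-negative integers. -/
def SeqLe (a a' : ℕ → ℕ) : Prop := a = a' ∨ SeqLt a a'

namespace WeakLowerPerfectSpace

variable {k I P V : Type*} [Field k] [AddCommGroup P] [AddCommGroup V] [Module k V]

/-- The composite `f_{i_1 l_1}^{a_1} ⋯ f_{i_m l_m}^{a_m}` (as an endomorphism, the
rightmost factor acting first). -/
noncomputable def pprod (S : WeakLowerPerfectSpace k I P V) (seq : ℕ → I × ℕ+)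
    (a : ℕ → ℕ) (m : ℕ) : Module.End k V :=
  ((List.range m).map fun j => S.f (seq j) ^ a j).prod

/-- The subspace `V^{>i,a} = Σ_{k=1}^r f_{i_1l_1}^{a_1}⋯f_{i_{k−1}l_{k−1}}^{a_{k−1}} f_{i_kl_k}^{a_k+1} V`. -/
noncomputable def Vgt (S : WeakLowerPerfectSpace k I P V) (seq : ℕ → I × ℕ+)
    (a : ℕ → ℕ) (r : ℕ) : Submodule k V :=
  ⨆ m : Fin r, LinearMap.range (S.pprod seq a (m : ℕ) * S.f (seq (m : ℕ)) ^ (a (m : ℕ) + 1))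

/-- The subspace `V^{≥i,a} = V^{>i,a} + f_{i_1l_1}^{a_1}⋯f_{i_rl_r}^{a_r} V`. -/
noncomputable def Vge (S : WeakLowerPerfectSpace k I P V) (seq : ℕ → I × ℕ+)
    (a : ℕ → ℕ) (r : ℕ) : Submodule k V :=
  S.Vgt seq a r ⊔ LinearMap.range (S.pprod seq a r)

end WeakLowerPerfectSpace

namespace WeakLowerPerfectSpace

variable {k I P V : Type*} [Field k] [AddCommGroup P] [AddCommGroup V] [Module k V]

theorem exists_nonneg_of_mem_closure (S : WeakLowerPerfectSpace k I P V) {x : P}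
    (hx : x ∈ AddSubmonoid.closure (Set.range S.alpha)) :
    ∃ c : I →₀ ℤ, 0 ≤ c ∧ Finsupp.linearCombination ℤ S.alpha c = x := by
  induction hx using AddSubmonoid.closure_induction with
  | mem x hx =>
    obtain ⟨i, rfl⟩ := hx
    exact ⟨Finsupp.single i 1, by simp, by simp⟩
  | zero => exact ⟨0, le_rfl, by simp⟩
  | add x y _ _ hx hy =>
    obtain ⟨c, hc, rfl⟩ := hx
    obtain ⟨c', hc', rfl⟩ := hy
    exact ⟨c + c', add_nonneg hc hc', map_add _ _ _⟩

theorem bddAbove_sub_nsmul_mem_closure (S : WeakLowerPerfectSpace k I P V) (i : I) (x : P) :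
    BddAbove {n : ℕ | x - n • S.alpha i ∈ AddSubmonoid.closure (Set.range S.alpha)} := by
  rcases Set.eq_empty_or_nonempty
    {n : ℕ | x - n • S.alpha i ∈ AddSubmonoid.closure (Set.range S.alpha)} with h | ⟨m, hm⟩
  · simp [h]
  obtain ⟨c, -, hc⟩ := S.exists_nonneg_of_mem_closure hm
  refine ⟨(c i + m).toNat, fun n hn => ?_⟩
  obtain ⟨c', hc'0, hc'⟩ := S.exists_nonneg_of_mem_closure hn
  have key : c + Finsupp.single i (m : ℤ) = c' + Finsupp.single i (n : ℤ) := by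
    apply S.alpha_indep
    simp [map_add, hc, hc', Finsupp.linearCombination_single]
  have h1 := DFunLike.congr_fun key i
  have h2 := hc'0 i
  simp only [Finsupp.add_apply, Finsupp.single_eq_same, Finsupp.coe_zero, Pi.zero_apply] at h1 h2
  omega

theorem map_pow_weight_le (S : WeakLowerPerfectSpace k I P V) (i : I) (l : ℕ+) (n : ℕ) (μ : P) :
    (S.weight μ).map (S.f (i, l) ^ n) ≤ S.weight (μ - (n * (l : ℕ)) • S.alpha i) := by
  induction n with
  | zero => simp [Module.End.one_eq_id]
  | succ n ih =>
    rw [pow_succ', Module.End.mul_eq_comp, Submodule.map_comp]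
    refine (Submodule.map_mono ih).trans ((S.f_weight i l _).trans_eq ?_)
    rw [sub_sub, ← add_nsmul, Nat.succ_mul]

theorem weight_ne_bot_of_mem_range_pow (S : WeakLowerPerfectSpace k I P V) {i : I} {l : ℕ+}
    {n : ℕ} {μ : P} {v : V} (hv : v ≠ 0) (hμ : v ∈ S.weight μ)
    (hn : v ∈ LinearMap.range (S.f (i, l) ^ n)) :
    S.weight (μ + (n * (l : ℕ)) • S.alpha i) ≠ ⊥ := by
  intro hbot
  have hle : LinearMap.range (S.f (i, l) ^ n) ≤ ⨆ ν, ⨆ _ : ν ≠ μ, S.weight ν := by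
    rw [LinearMap.range_eq_map, ← S.weight_sup, Submodule.map_iSup]
    refine iSup_le fun ν => ?_
    by_cases hν : ν - (n * (l : ℕ)) • S.alpha i = μ
    · rw [sub_eq_iff_eq_add.mp hν, hbot, Submodule.map_bot]
      exact bot_le
    · exact (S.map_pow_weight_le i l n ν).trans (le_iSup₂_of_le _ hν le_rfl)
  exact hv (Submodule.disjoint_def.mp (S.weight_indep μ) v hμ (hle hn))

theorem bddAbove_mem_range_pow (S : WeakLowerPerfectSpace k I P V) (il : I × ℕ+) {μ : P} {v : V}
    (hv : v ≠ 0) (hμ : v ∈ S.weight μ) :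
    BddAbove {n : ℕ | v ∈ LinearMap.range (S.f il ^ n)} := by
  obtain ⟨i, l⟩ := il
  obtain ⟨s, hs⟩ := S.support_bounded
  have hfin : BddAbove (⋃ lam ∈ s, {n : ℕ | lam - μ - n • S.alpha i ∈
      AddSubmonoid.closure (Set.range S.alpha)}) :=
    (s.finite_toSet.bddAbove_biUnion).mpr fun lam _ => S.bddAbove_sub_nsmul_mem_closure i _
  obtain ⟨N, hN⟩ := hfin
  refine ⟨N, fun n hn => ?_⟩
  obtain ⟨lam, hlam, hmem⟩ := hs _ (S.weight_ne_bot_of_mem_range_pow hv hμ hn)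
  refine (Nat.le_mul_of_pos_right n l.pos).trans (hN ?_)
  simp only [Set.mem_iUnion]
  exact ⟨lam, hlam, by simpa [sub_sub] using hmem⟩

theorem mem_range_pow_d (S : WeakLowerPerfectSpace k I P V) (il : I × ℕ+) (v : V) :
    v ∈ LinearMap.range (S.f il ^ S.d il v) := by
  by_cases h : BddAbove {n : ℕ | v ∈ LinearMap.range (S.f il ^ n)}
  · exact Nat.sSup_mem ⟨0, by simp⟩ h
  · rw [d, Nat.sSup_of_not_bddAbove h]
    simp

theorem range_pow_anti (S : WeakLowerPerfectSpace k I P V) (il : I × ℕ+) {m n : ℕ} (h : m ≤ n) :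
    LinearMap.range (S.f il ^ n) ≤ LinearMap.range (S.f il ^ m) :=
  (S.f il).iterateRange.monotone h

theorem map_mem_range_pow (S : WeakLowerPerfectSpace k I P V) (il : I × ℕ+) (m : ℕ) {n : ℕ} {v : V}
    (h : v ∈ LinearMap.range (S.f il ^ n)) :
    (S.f il ^ m) v ∈ LinearMap.range (S.f il ^ (m + n)) := by
  obtain ⟨w, rfl⟩ := h
  exact ⟨w, by rw [pow_add, Module.End.mul_apply]⟩

theorem pprod_succ (S : WeakLowerPerfectSpace k I P V) (seq : ℕ → I × ℕ+) (a : ℕ → ℕ) (m : ℕ) :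
    S.pprod seq a (m + 1) = S.pprod seq a m * S.f (seq m) ^ a m := by
  simp [pprod, List.range_succ]

theorem Vgt_le_succ (S : WeakLowerPerfectSpace k I P V) (seq : ℕ → I × ℕ+) (a : ℕ → ℕ) (r : ℕ) :
    S.Vgt seq a r ≤ S.Vgt seq a (r + 1) :=
  iSup_le fun m => le_iSup (fun m : Fin (r + 1) =>
    LinearMap.range (S.pprod seq a m * S.f (seq m) ^ (a m + 1))) m.castSucc

theorem range_le_Vgt_succ (S : WeakLowerPerfectSpace k I P V) (seq : ℕ → I × ℕ+) (a : ℕ → ℕ)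
    (r : ℕ) : LinearMap.range (S.pprod seq a r * S.f (seq r) ^ (a r + 1)) ≤
      S.Vgt seq a (r + 1) :=
  le_iSup (fun m : Fin (r + 1) =>
    LinearMap.range (S.pprod seq a m * S.f (seq m) ^ (a m + 1))) (Fin.last r)

end WeakLowerPerfectSpace

theorem fComp_zero_right {V ι : Type*} [Zero V] {F : ι → V → V} (hF : ∀ i, F i 0 = 0)
    (seq : ℕ → ι) (a : ℕ → ℕ) (r : ℕ) : fComp F seq a r 0 = 0 := by
  induction r with
  | zero => rfl
  | succ r ih => rw [fComp, Function.iterate_fixed (hF _), ih]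

namespace LowerPerfectBasis

variable {k I P V : Type*} [Field k] [AddCommGroup P] [AddCommGroup V] [Module k V]
  {S : WeakLowerPerfectSpace k I P V} {B : Set V}

theorem F_mem_range_pow (LB : LowerPerfectBasis S B) (il : I × ℕ+) {b : V} (hb : b ∈ B) :
    LB.F il b ∈ LinearMap.range (S.f il ^ (S.d il b + 1)) := by
  obtain ⟨c, hc⟩ := LB.F_approx il b hb
  have h1 : S.f il b ∈ LinearMap.range (S.f il ^ (S.d il b + 1)) := by
    simpa [add_comm] using S.map_mem_range_pow il 1 (S.mem_range_pow_d il b)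
  have h2 := sub_mem h1 (S.range_pow_anti il (Nat.le_succ _) hc)
  rw [sub_sub_cancel] at h2
  exact (Submodule.smul_mem_iff _ c.ne_zero).mp h2

theorem d_lt_d_F (LB : LowerPerfectBasis S B) (il : I × ℕ+) {b : V} (hb : b ∈ B)
    (hF : LB.F il b ∈ B) : S.d il b < S.d il (LB.F il b) := by
  obtain ⟨μ, hμ⟩ := LB.graded _ hF
  exact le_csSup (S.bddAbove_mem_range_pow il (LB.indep.ne_zero ⟨_, hF⟩) hμ)
    (LB.F_mem_range_pow il hb)

theorem iterate_F_mem (LB : LowerPerfectBasis S B) (il : I × ℕ+) {b : V} (hb : b ∈ B) (n : ℕ) :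
    (LB.F il)^[n] b ∈ B ∪ {0} := by
  induction n with
  | zero => exact Or.inl hb
  | succ n ih =>
    rw [Function.iterate_succ_apply']
    rcases ih with h | h
    · exact LB.F_mem il _ h
    · rw [Set.mem_singleton_iff.mp h, LB.F_zero]
      exact Or.inr rfl

theorem exists_pow_sub_smul_iterate_mem (LB : LowerPerfectBasis S B) (il : I × ℕ+) (n : ℕ)
    {b : V} (hb : b ∈ B) :
    ∃ c : kˣ, (S.f il ^ n) b - (c : k) • (LB.F il)^[n] b ∈
      LinearMap.range (S.f il ^ (n + (S.d il b + 1))) := by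
  induction n generalizing b with
  | zero => exact ⟨1, by simp⟩
  | succ n ih =>
    obtain ⟨c, hc⟩ := LB.F_approx il b hb
    have h1 := S.map_mem_range_pow il n hc
    rw [map_sub, map_smul, ← Module.End.mul_apply, ← pow_succ] at h1
    rw [show n + (S.d il b + 2) = n + 1 + (S.d il b + 1) by omega] at h1
    rcases LB.F_mem il b hb with hF | hF
    · obtain ⟨c', hc'⟩ := ih hF
      refine ⟨c * c', ?_⟩
      have hlt := LB.d_lt_d_F il hb hF
      have h2 := S.range_pow_anti il
        (show n + 1 + (S.d il b + 1) ≤ n + (S.d il (LB.F il b) + 1) by omega) hc'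
      have h3 := add_mem h1 (Submodule.smul_mem _ (c : k) h2)
      rwa [smul_sub, smul_smul, sub_add_sub_cancel] at h3
    · have h0 : LB.F il b = 0 := hF
      refine ⟨1, ?_⟩
      rw [Function.iterate_succ_apply, h0, Function.iterate_fixed (LB.F_zero il)]
      simpa [h0] using h1

end LowerPerfectBasis

theorem stmt_5 {k I P V : Type*} [Field k] [AddCommGroup P] [AddCommGroup V] [Module k V]
    (S : WeakLowerPerfectSpace k I P V) (B : Set V) (LB : LowerPerfectBasis S B)
    (r : ℕ) (seq : ℕ → I × ℕ+) (a : ℕ → ℕ) (b : V) (hb : b ∈ B) :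
    ∃ c : kˣ, S.pprod seq a r b - (c : k) • fComp LB.F seq a r b ∈ S.Vgt seq a r := by
  induction r generalizing b with
  | zero => exact ⟨1, by simp [WeakLowerPerfectSpace.pprod, fComp]⟩
  | succ r ih =>
    obtain ⟨c, hc⟩ := LB.exists_pow_sub_smul_iterate_mem (seq r) (a r) hb
    obtain ⟨w, hw⟩ := S.range_pow_anti (seq r)
      (show a r + 1 ≤ a r + (S.d (seq r) b + 1) by omega) hc
    have h1 : S.pprod seq a (r + 1) b
        - (c : k) • S.pprod seq a r ((LB.F (seq r))^[a r] b) ∈ S.Vgt seq a (r + 1) := by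
      refine S.range_le_Vgt_succ seq a r ⟨w, ?_⟩
      rw [Module.End.mul_apply, hw, map_sub, map_smul, S.pprod_succ, Module.End.mul_apply]
    rcases LB.iterate_F_mem (seq r) hb (a r) with hF | hF
    · obtain ⟨c', hc'⟩ := ih _ hF
      refine ⟨c * c', ?_⟩
      have h2 := add_mem h1 (Submodule.smul_mem _ (c : k) (S.Vgt_le_succ seq a r hc'))
      rwa [smul_sub, smul_smul, sub_add_sub_cancel] at h2
    · have h0 : (LB.F (seq r))^[a r] b = 0 := hF
      refine ⟨1, ?_⟩
      rw [fComp, h0, fComp_zero_right LB.F_zero]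
      simpa [h0] using h1
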